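/- Let 𝔤 be a finite-dimensional real nilpotent Lie algebra with γ_{s+1}(𝔤) = 0 for some s ≥ 1, equipped with a norm ‖·‖ and with fixed linear subspaces A_1, …, A_s such that γ_i(𝔤) = A_i ⊕ γ_{i+1}(𝔤) for every 1 ≤ i ≤ s. Then there exists C ≥ 1 such that for all integers p, q ≥ 1 with p + q ≤ s and all x ∈ γ_p(𝔤), y ∈ γ_q(𝔤), one has |[x,y]| ≤ C·max{ |x|^{i/(i+j)}·|y|^{j/(i+j)} : i ≥ p, j ≥ q, i + j ≤ s }, where |·| denotes the Guivarc'h gauge. -/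

import Mathlib

open scoped BigOperators

/-- The Guivarc'h gauge `|x| := 1 + Σ_{i=1}^{s} ‖x_i‖^{1/i}`, where `x = Σ_i x_i` with
`x_i = π i x` the component of `x` in the subspace `A_i`, and `N` is the chosen norm. -/
noncomputable def guivarchGauge {L : Type*} [LieRing L] [LieAlgebra ℝ L]
    (N : L → ℝ) (π : ℕ → L →ₗ[ℝ] L) (s : ℕ) (x : L) : ℝ :=
  1 + ∑ i ∈ Finset.Icc 1 s, (N (π i x)) ^ ((1 : ℝ) / (i : ℝ))

theorem LieModule.lie_mem_lowerCentralSeries_add {R L : Type*} [CommRing R] [LieRing L]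
    [LieAlgebra R L] {a b : ℕ} {x y : L} (hx : x ∈ LieModule.lowerCentralSeries R L L a)
    (hy : y ∈ LieModule.lowerCentralSeries R L L b) :
    ⁅x, y⁆ ∈ LieModule.lowerCentralSeries R L L (a + b + 1) := by
  induction a generalizing b x y with
  | zero =>
    rw [zero_add, LieModule.lowerCentralSeries_succ]
    exact LieSubmodule.lie_mem_lie (LieSubmodule.mem_top x) hy
  | succ a ih =>
    rw [LieModule.lowerCentralSeries_succ, ← LieSubmodule.mem_toSubmodule,
      LieSubmodule.lieIdeal_oper_eq_linear_span'] at hx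
    induction hx using Submodule.span_induction with
    | mem z hz =>
      obtain ⟨u, -, v, hv, rfl⟩ := hz
      rw [lie_lie]
      refine sub_mem ?_ ?_
      · rw [show a + 1 + b + 1 = (a + b + 1) + 1 by ring, LieModule.lowerCentralSeries_succ]
        exact LieSubmodule.lie_mem_lie (LieSubmodule.mem_top u) (ih hv hy)
      · rw [show a + 1 + b + 1 = a + (b + 1) + 1 by ring]
        refine ih hv ?_
        rw [LieModule.lowerCentralSeries_succ]
        exact LieSubmodule.lie_mem_lie (LieSubmodule.mem_top u) hy
    | zero => simp
    | add u v _ _ hu hv => rw [add_lie]; exact add_mem hu hv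
    | smul c u _ hu => rw [smul_lie]; exact SMulMemClass.smul_mem c hu

/-- A bilinear map on a finite-dimensional space is bounded with respect to any norm, the norm
being given as an unbundled function. -/
theorem LinearMap.exists_bound_of_finiteDimensional₂ {E : Type*} [AddCommGroup E] [Module ℝ E]
    [FiniteDimensional ℝ E] (N : E → ℝ) (hN_nonneg : ∀ x, 0 ≤ N x)
    (hN_eq_zero : ∀ x, N x = 0 ↔ x = 0) (hN_add : ∀ x y, N (x + y) ≤ N x + N y)
    (hN_smul : ∀ (r : ℝ) (x : E), N (r • x) = |r| * N x) (B : E →ₗ[ℝ] E →ₗ[ℝ] E) :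
    ∃ K : ℝ, 0 ≤ K ∧ ∀ x y, N (B x y) ≤ K * N x * N y := by
  let : Norm E := ⟨N⟩
  have core : NormedSpace.Core ℝ E :=
    { norm_nonneg := hN_nonneg
      norm_smul := hN_smul
      norm_triangle := hN_add
      norm_eq_zero_iff := hN_eq_zero }
  let : NormedAddCommGroup E := NormedAddCommGroup.ofCore core
  let : NormedSpace ℝ E := NormedSpace.ofCore core
  exact ⟨‖B.toContinuousBilinearMap‖, ContinuousLinearMap.opNorm_nonneg _, fun x y ↦
    B.toContinuousBilinearMap.le_opNorm₂ x y⟩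

theorem map_sum_le_of_forall_le {E ι : Type*} [AddCommMonoid E] (N : E → ℝ) (hN_zero : N 0 = 0)
    (hN_add : ∀ x y, N (x + y) ≤ N x + N y) (t : Finset ι) (f : ι → E) (c : ℝ)
    (h : ∀ i ∈ t, N (f i) ≤ c) : N (∑ i ∈ t, f i) ≤ t.card * c := by
  refine (Finset.le_sum_of_subadditive N hN_zero.le hN_add t f).trans ?_
  rw [← nsmul_eq_mul]
  exact Finset.sum_le_card_nsmul t _ c h

theorem apply_eq_zero_of_mem_lowerCentralSeries {L : Type*} [LieRing L] [LieAlgebra ℝ L] {s : ℕ}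
    {A : ℕ → Submodule ℝ L}
    (hA_sup : ∀ i, 1 ≤ i → i ≤ s →
      A i ⊔ LieSubmodule.toSubmodule (LieModule.lowerCentralSeries ℝ L L i)
        = LieSubmodule.toSubmodule (LieModule.lowerCentralSeries ℝ L L (i - 1)))
    (hA_disj : ∀ i, 1 ≤ i → i ≤ s →
      Disjoint (A i) (LieSubmodule.toSubmodule (LieModule.lowerCentralSeries ℝ L L i)))
    {π : ℕ → L →ₗ[ℝ] L} (hπ_mem : ∀ i x, π i x ∈ A i)
    (hπ_sum : ∀ x : L, ∑ i ∈ Finset.Icc 1 s, π i x = x) {m i : ℕ} (hi : 1 ≤ i) (his : i ≤ s)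
    (him : i ≤ m) {x : L} (hx : x ∈ LieModule.lowerCentralSeries ℝ L L m) : π i x = 0 := by
  induction i using Nat.strong_induction_on with
  | _ i ih =>
    refine Submodule.disjoint_def.mp (hA_disj i hi his) _ (hπ_mem i x) ?_
    have hmem : i ∈ Finset.Icc 1 s := Finset.mem_Icc.mpr ⟨hi, his⟩
    have hsplit := Finset.add_sum_erase _ (fun j ↦ π j x) hmem
    rw [hπ_sum] at hsplit
    rw [eq_sub_of_add_eq hsplit]
    refine sub_mem (LieModule.antitone_lowerCentralSeries ℝ L L him hx) (sum_mem fun j hj ↦ ?_)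
    obtain ⟨hji, hj⟩ := Finset.mem_erase.mp hj
    obtain ⟨hj1, hjs⟩ := Finset.mem_Icc.mp hj
    rcases lt_or_gt_of_ne hji with hlt | hgt
    · rw [ih j hlt hj1 hjs (by omega)]
      exact zero_mem _
    · have hle : A j ≤ LieSubmodule.toSubmodule (LieModule.lowerCentralSeries ℝ L L (j - 1)) :=
        le_sup_left.trans (hA_sup j hj1 hjs).le
      exact LieModule.antitone_lowerCentralSeries ℝ L L (show i ≤ j - 1 by omega)
        (hle (hπ_mem j x))

section Gauge

variable {L : Type*} [LieRing L] [LieAlgebra ℝ L] {N : L → ℝ}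

theorem one_le_guivarchGauge (hN_nonneg : ∀ x, 0 ≤ N x)
    (π : ℕ → L →ₗ[ℝ] L) (s : ℕ) (x : L) : 1 ≤ guivarchGauge N π s x :=
  le_add_of_nonneg_right (Finset.sum_nonneg fun _ _ ↦ Real.rpow_nonneg (hN_nonneg _) _)

theorem norm_apply_le_guivarchGauge_pow (hN_nonneg : ∀ x, 0 ≤ N x)
    (π : ℕ → L →ₗ[ℝ] L) (s : ℕ) {i : ℕ}
    (hi : i ∈ Finset.Icc 1 s) (x : L) :
    N (π i x) ≤ guivarchGauge N π s x ^ i := by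
  have hi0 : i ≠ 0 := by have := (Finset.mem_Icc.mp hi).1; omega
  have hroot : N (π i x) ^ ((1 : ℝ) / i) ≤ guivarchGauge N π s x :=
    (Finset.single_le_sum (f := fun i : ℕ ↦ N (π i x) ^ ((1 : ℝ) / (i : ℝ)))
      (fun j _ ↦ Real.rpow_nonneg (hN_nonneg _) _) hi).trans
      (le_add_of_nonneg_left zero_le_one)
  calc N (π i x) = (N (π i x) ^ ((1 : ℝ) / i)) ^ i := by
        rw [one_div, Real.rpow_inv_natCast_pow (hN_nonneg _) hi0]
    _ ≤ _ := pow_le_pow_left₀ (Real.rpow_nonneg (hN_nonneg _) _) hroot i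

theorem guivarchGauge_le_of_norm_apply_le (hN_nonneg : ∀ x, 0 ≤ N x)
    (π : ℕ → L →ₗ[ℝ] L) (s : ℕ) {c M : ℝ}
    (hc : 1 ≤ c) (hM : 1 ≤ M) (x : L)
    (h : ∀ k ∈ Finset.Icc 1 s, N (π k x) ≤ c * M ^ k) :
    guivarchGauge N π s x ≤ (1 + s * c) * M := by
  have hroot : ∀ k ∈ Finset.Icc 1 s, N (π k x) ^ ((1 : ℝ) / (k : ℝ)) ≤ c * M := by
    intro k hk
    have hk1 := (Finset.mem_Icc.mp hk).1
    rw [one_div, Real.rpow_inv_le_iff_of_pos (hN_nonneg _) (by positivity)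
      (Nat.cast_pos.mpr hk1), Real.rpow_natCast, mul_pow]
    refine (h k hk).trans ?_
    gcongr
    exact le_self_pow₀ hc (by omega)
  have hsum := Finset.sum_le_card_nsmul _ _ _ hroot
  rw [Nat.card_Icc, Nat.add_sub_cancel, nsmul_eq_mul] at hsum
  unfold guivarchGauge
  linarith

end Gauge

/-- In a finite-dimensional real nilpotent Lie algebra `𝔤` with `γ_{s+1}(𝔤) = 0`,
fixed complements `A_i` of `γ_{i+1}(𝔤)` inside `γ_i(𝔤)` and the associated Guivarc'h gauge,
there is `C ≥ 1` such that for all `p, q ≥ 1` with `p + q ≤ s` and all `x ∈ γ_p(𝔤)`,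
`y ∈ γ_q(𝔤)`, the gauge of `[x,y]` is at most
`C·max{ |x|^{i/(i+j)}·|y|^{j/(i+j)} : i ≥ p, j ≥ q, i+j ≤ s }`; i.e. it is bounded by
`C·|x|^{i/(i+j)}·|y|^{j/(i+j)}` for some admissible pair `(i,j)`.
Here `γ_i(𝔤)` is `LieModule.lowerCentralSeries ℝ 𝔤 𝔤 (i-1)`. -/
theorem guivarch_gauge_bracket_bound_lcs
    {L : Type*} [LieRing L] [LieAlgebra ℝ L] [FiniteDimensional ℝ L]
    (s : ℕ) (hs : 1 ≤ s)
    (hnil : LieModule.lowerCentralSeries ℝ L L s = ⊥)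
    (A : ℕ → Submodule ℝ L)
    (hA_sup : ∀ i, 1 ≤ i → i ≤ s →
      A i ⊔ LieSubmodule.toSubmodule (LieModule.lowerCentralSeries ℝ L L i)
        = LieSubmodule.toSubmodule (LieModule.lowerCentralSeries ℝ L L (i - 1)))
    (hA_disj : ∀ i, 1 ≤ i → i ≤ s →
      Disjoint (A i) (LieSubmodule.toSubmodule (LieModule.lowerCentralSeries ℝ L L i)))
    (N : L → ℝ)
    (hN_nonneg : ∀ x, 0 ≤ N x)
    (hN_eq_zero : ∀ x, N x = 0 ↔ x = 0)
    (hN_add : ∀ x y, N (x + y) ≤ N x + N y)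
    (hN_smul : ∀ (r : ℝ) (x : L), N (r • x) = |r| * N x)
    (π : ℕ → L →ₗ[ℝ] L)
    (hπ_mem : ∀ i x, π i x ∈ A i)
    (hπ_sum : ∀ x : L, ∑ i ∈ Finset.Icc 1 s, π i x = x) :
    ∃ C : ℝ, 1 ≤ C ∧ ∀ p q : ℕ, 1 ≤ p → 1 ≤ q → p + q ≤ s →
      ∀ x ∈ LieModule.lowerCentralSeries ℝ L L (p - 1),
        ∀ y ∈ LieModule.lowerCentralSeries ℝ L L (q - 1),
          ∃ i j : ℕ, p ≤ i ∧ q ≤ j ∧ i + j ≤ s ∧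
            guivarchGauge N π s ⁅x, y⁆
              ≤ C * (guivarchGauge N π s x ^ ((i : ℝ) / ((i : ℝ) + (j : ℝ)))
                  * guivarchGauge N π s y ^ ((j : ℝ) / ((i : ℝ) + (j : ℝ)))) := by
  have hN_zero : N 0 = 0 := (hN_eq_zero 0).mpr rfl
  have hbound (k : ℕ) : ∃ K : ℝ, 0 ≤ K ∧ ∀ x y, N (π k ⁅x, y⁆) ≤ K * N x * N y :=
    LinearMap.exists_bound_of_finiteDimensional₂ N hN_nonneg hN_eq_zero hN_add hN_smul
      ((LieModule.toEnd ℝ L L : L →ₗ[ℝ] L →ₗ[ℝ] L).compr₂ (π k))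
  choose κ hκ_nonneg hκ using hbound
  set K : ℝ := 1 + ∑ k ∈ Finset.Icc 1 s, κ k
  have hK_one : 1 ≤ K := le_add_of_nonneg_right (Finset.sum_nonneg fun k _ ↦ hκ_nonneg k)
  have hκ_le : ∀ k ∈ Finset.Icc 1 s, κ k ≤ K := fun k hk ↦
    (Finset.single_le_sum (fun k _ ↦ hκ_nonneg k) hk).trans (le_add_of_nonneg_left zero_le_one)
  have hs_one : (1 : ℝ) ≤ s := by exact_mod_cast hs
  have hc : 1 ≤ (s : ℝ) * (s * K) :=
    one_le_mul_of_one_le_of_one_le hs_one (one_le_mul_of_one_le_of_one_le hs_one hK_one)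
  refine ⟨1 + s * (s * (s * K)), le_add_of_nonneg_right (by positivity), ?_⟩
  intro p q hp hq hpq x hx y hy
  set X := guivarchGauge N π s x
  set Y := guivarchGauge N π s y
  have hX : 1 ≤ X := one_le_guivarchGauge hN_nonneg π s x
  have hY : 1 ≤ Y := one_le_guivarchGauge hN_nonneg π s y
  let m : ℕ × ℕ → ℝ := fun ij ↦ X ^ ((ij.1 : ℝ) / ((ij.1 : ℝ) + (ij.2 : ℝ))) *
    Y ^ ((ij.2 : ℝ) / ((ij.1 : ℝ) + (ij.2 : ℝ)))
  let T : Finset (ℕ × ℕ) :=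
    (Finset.Icc p s ×ˢ Finset.Icc q s).filter fun ij ↦ ij.1 + ij.2 ≤ s
  have hmemT {i j : ℕ} (hi : p ≤ i) (hj : q ≤ j) (hij : i + j ≤ s) : (i, j) ∈ T := by
    simp only [T, Finset.mem_filter, Finset.mem_product, Finset.mem_Icc]
    omega
  obtain ⟨⟨i₀, j₀⟩, hT, hmax⟩ := T.exists_max_image m ⟨_, hmemT le_rfl le_rfl hpq⟩
  simp only [T, Finset.mem_filter, Finset.mem_product, Finset.mem_Icc] at hT
  refine ⟨i₀, j₀, hT.1.1.1, hT.1.2.1, hT.2, ?_⟩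
  set M : ℝ := m (i₀, j₀)
  have hM_one : 1 ≤ M := one_le_mul_of_one_le_of_one_le
    (Real.one_le_rpow hX (by positivity)) (Real.one_le_rpow hY (by positivity))
  refine guivarchGauge_le_of_norm_apply_le hN_nonneg π s hc hM_one _ fun k hk ↦ ?_
  obtain ⟨hk1, hks⟩ := Finset.mem_Icc.mp hk
  have hterm : ∀ i ∈ Finset.Icc 1 s, ∀ j ∈ Finset.Icc 1 s,
      N (π k ⁅π i x, π j y⁆) ≤ K * M ^ k := by
    intro i hi j hj
    obtain ⟨hi1, his⟩ := Finset.mem_Icc.mp hi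
    obtain ⟨hj1, hjs⟩ := Finset.mem_Icc.mp hj
    have hzero (h : π k ⁅π i x, π j y⁆ = 0) : N (π k ⁅π i x, π j y⁆) ≤ K * M ^ k := by
      rw [h, hN_zero]
      positivity
    have hA_le {l : ℕ} (h1 : 1 ≤ l) (hl : l ≤ s) (z : L) :
        π l z ∈ LieModule.lowerCentralSeries ℝ L L (l - 1) :=
      (le_sup_left.trans (hA_sup l h1 hl).le) (hπ_mem l z)
    rcases lt_or_ge i p with hip | hip
    · apply hzero
      rw [apply_eq_zero_of_mem_lowerCentralSeries hA_sup hA_disj hπ_mem hπ_sum hi1 his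
        (by omega) hx, zero_lie, map_zero]
    rcases lt_or_ge j q with hjq | hjq
    · apply hzero
      rw [apply_eq_zero_of_mem_lowerCentralSeries hA_sup hA_disj hπ_mem hπ_sum hj1 hjs
        (by omega) hy, lie_zero, map_zero]
    rcases lt_or_ge k (i + j) with hkij | hkij
    · exact hzero (apply_eq_zero_of_mem_lowerCentralSeries hA_sup hA_disj hπ_mem hπ_sum hk1 hks
        (by omega) (LieModule.lie_mem_lowerCentralSeries_add (hA_le hi1 his x) (hA_le hj1 hjs y)))
    have hij : (i : ℝ) + j ≠ 0 := by positivity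
    have hpow : X ^ i * Y ^ j = m (i, j) ^ (i + j) := by
      simp only [m]
      rw [mul_pow, ← Real.rpow_natCast, ← Real.rpow_natCast, ← Real.rpow_natCast,
        ← Real.rpow_natCast, ← Real.rpow_mul (by positivity), ← Real.rpow_mul (by positivity)]
      push_cast
      rw [div_mul_cancel₀ _ hij, div_mul_cancel₀ _ hij]
    calc N (π k ⁅π i x, π j y⁆) ≤ κ k * N (π i x) * N (π j y) := hκ k _ _
      _ ≤ K * X ^ i * Y ^ j := by
        gcongr
        · exact hN_nonneg _
        · exact hN_nonneg _
        · exact hκ_le k hk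
        · exact norm_apply_le_guivarchGauge_pow hN_nonneg π s hi x
        · exact norm_apply_le_guivarchGauge_pow hN_nonneg π s hj y
      _ = K * m (i, j) ^ (i + j) := by rw [mul_assoc, hpow]
      _ ≤ K * M ^ (i + j) := by
        gcongr
        exact hmax _ (hmemT hip hjq (by omega))
      _ ≤ K * M ^ k := by gcongr
  have hcard : (Finset.Icc 1 s).card = s := by simp
  have hexp : π k ⁅x, y⁆ =
      ∑ i ∈ Finset.Icc 1 s, ∑ j ∈ Finset.Icc 1 s, π k ⁅π i x, π j y⁆ := by
    conv_lhs => rw [← hπ_sum x, ← hπ_sum y]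
    simp only [sum_lie, lie_sum, map_sum]
    exact Finset.sum_comm
  rw [hexp]
  refine (map_sum_le_of_forall_le N hN_zero hN_add _ _ (s * (K * M ^ k)) fun i hi ↦ ?_).trans_eq ?_
  · refine (map_sum_le_of_forall_le N hN_zero hN_add _ _ _ (hterm i hi)).trans_eq ?_
    rw [hcard]
  · rw [hcard]
    ring
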